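/- arXiv:2507.09773 — 2 statements merged into one kernel-verified Lean document; each statement's English description precedes it below -/
import Mathlib

section
/- Let G be a finite group with an automorphism σ of prime order ℓ, Γ = ⟨σ⟩. Let M be a Λ[G ⋊ Γ]-module, where Λ = ℤ_ℓ (or its unramified integral extension), which is a free Λ-module of finite rank. Assume Ĥ¹(Γ, M) = 0. Then for every g ∈ G^σ, the trace of g acting on Ĥ⁰(Γ, M) (an 𝔽_ℓ-vector space) equals the mod-ℓ reduction of the trace of g acting on M. -/
open LinearMap in
theorem tr_exact {F U V W : Type*} [Field F] [AddCommGroup U] [AddCommGroup V] [AddCommGroup W]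
    [Module F U] [Module F V] [Module F W] [FiniteDimensional F V]
    (i : U →ₗ[F] V) (f : V →ₗ[F] W) (hi : Function.Injective i) (hf : Function.Surjective f)
    (hex : ∀ v, f v = 0 ↔ ∃ u, i u = v)
    (a : U →ₗ[F] U) (b : V →ₗ[F] V) (c : W →ₗ[F] W)
    (hab : ∀ u, b (i u) = i (a u)) (hbc : ∀ v, f (b v) = c (f v)) :
    LinearMap.trace F V b = LinearMap.trace F U a + LinearMap.trace F W c := by
  have : FiniteDimensional F U := FiniteDimensional.of_injective i hi
  have : FiniteDimensional F W := Module.Finite.of_surjective f hf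
  obtain ⟨s, hs⟩ := f.exists_rightInverse_of_surjective (LinearMap.range_eq_top.2 hf)
  obtain ⟨r₀, hr₀⟩ := i.exists_leftInverse_of_injective (LinearMap.ker_eq_bot.2 hi)
  have hs' : ∀ w, f (s w) = w := fun w => LinearMap.congr_fun hs w
  have hr' : ∀ w, r₀ (i w) = w := fun w => LinearMap.congr_fun hr₀ w
  have hfi : ∀ u, f (i u) = 0 := fun u => (hex _).2 ⟨u, rfl⟩
  have key : ∀ v, i (r₀ (v - s (f v))) + s (f v) = v := by
    intro v
    obtain ⟨u, hu⟩ := (hex (v - s (f v))).1 (by rw [map_sub, hs', sub_self])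
    rw [← hu, hr', hu]; abel
  set r : V →ₗ[F] U := r₀ ∘ₗ (LinearMap.id - s ∘ₗ f) with hr
  have e1 : b = (b ∘ₗ i) ∘ₗ r + (b ∘ₗ s) ∘ₗ f := by
    ext v
    simp only [hr, LinearMap.add_apply, LinearMap.comp_apply, LinearMap.sub_apply, LinearMap.id_apply]
    rw [← map_add, key]
  have e2 : r ∘ₗ (b ∘ₗ i) = a := by
    ext u
    simp only [hr, LinearMap.comp_apply, LinearMap.sub_apply, LinearMap.id_apply, hab, hfi, map_zero,
      sub_zero, hr']
  have e3 : f ∘ₗ (b ∘ₗ s) = c := by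
    ext u
    simp only [LinearMap.comp_apply, hbc, hs']
  conv_lhs => rw [e1]
  rw [map_add, LinearMap.trace_comp_comm', LinearMap.trace_comp_comm' f, e2, e3]

theorem norm_eq_pow (ℓ : ℕ) [Fact ℓ.Prime] {A : Type*} [Ring A] [Algebra (ZMod ℓ) A] (s : A) :
    ∑ i ∈ Finset.range ℓ, s ^ i = (1 - s) ^ (ℓ - 1) := by
  have hp : (∑ i ∈ Finset.range ℓ, (Polynomial.X : Polynomial (ZMod ℓ)) ^ i)
      = (1 - Polynomial.X) ^ (ℓ - 1) := by
    have h0 : (1 - Polynomial.X : Polynomial (ZMod ℓ)) ≠ 0 := by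
      intro h
      have := congrArg (Polynomial.eval 0) h
      simp at this
    apply mul_left_cancel₀ h0
    rw [mul_neg_geom_sum, mul_pow_sub_one (Fact.out : ℓ.Prime).ne_zero, sub_pow_char, one_pow]
  simpa using congrArg (Polynomial.aeval s) hp

/-- trace of a nilpotent filtration -/
theorem tr_main (ℓ : ℕ) [Fact ℓ.Prime] {V W : Type*} [AddCommGroup V] [AddCommGroup W]
    [Module (ZMod ℓ) V] [Module (ZMod ℓ) W] [FiniteDimensional (ZMod ℓ) V]
    (D T : Module.End (ZMod ℓ) V) (hDT : ∀ v, D (T v) = T (D v)) (hD : D ^ ℓ = 0)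
    (hK : ∀ y, D (D y) = 0 → ∃ u, D y = (D ^ (ℓ - 1)) u)
    (f : LinearMap.ker D →ₗ[ZMod ℓ] W) (hf : Function.Surjective f)
    (hker : ∀ v : LinearMap.ker D, f v = 0 ↔ ∃ u, (D ^ (ℓ - 1)) u = v)
    (c : W →ₗ[ZMod ℓ] W)
    (hc : ∀ v w : LinearMap.ker D, (w : V) = T v → f w = c (f v)) :
    LinearMap.trace (ZMod ℓ) W c = LinearMap.trace (ZMod ℓ) V T := by
  have hℓ : 1 ≤ ℓ := (Fact.out : ℓ.Prime).one_lt.le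
  have hDnT : ∀ n v, (D ^ n) (T v) = T ((D ^ n) v) := by
    intro n
    have : Commute D T := LinearMap.ext hDT
    exact fun v => LinearMap.congr_fun (this.pow_left n).eq v
  have hR : ∀ n, ∀ x ∈ LinearMap.range (D ^ n), T x ∈ LinearMap.range (D ^ n) := by
    rintro n _ ⟨v, rfl⟩
    exact ⟨T v, hDnT n v⟩
  have hKm : ∀ x ∈ LinearMap.ker D, T x ∈ LinearMap.ker D := by
    intro x hx
    rw [LinearMap.mem_ker] at *
    rw [hDT, hx, map_zero]
  have hDD : ∀ n u, D ((D ^ n) u) = (D ^ (n+1)) u := fun n u => by rw [pow_succ']; rfl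
  have hlast : ∀ u, D ((D ^ (ℓ - 1)) u) = 0 := by
    intro u
    rw [hDD, Nat.sub_add_cancel hℓ, hD]; rfl
  set t : ℕ → ZMod ℓ := fun n => LinearMap.trace (ZMod ℓ) _ (T.restrict (hR n)) with ht
  -- step
  have hstep : ∀ n, 1 ≤ n → n ≤ ℓ - 1 → t n = t (ℓ - 1) + t (n + 1) := by
    intro n h1 h2
    have hle : LinearMap.range (D ^ (ℓ - 1)) ≤ LinearMap.range (D ^ n) := by
      rintro _ ⟨v, rfl⟩
      refine ⟨(D ^ (ℓ - 1 - n)) v, ?_⟩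
      rw [← Module.End.mul_apply, ← pow_add, Nat.add_sub_cancel' h2]
    refine tr_exact (Submodule.inclusion hle)
      ((D.comp (LinearMap.range (D ^ n)).subtype).codRestrict (LinearMap.range (D ^ (n+1))) ?_)
      (Submodule.inclusion_injective hle) ?_ ?_ _ _ _ ?_ ?_
    · rintro ⟨_, ⟨v, rfl⟩⟩
      exact ⟨v, (hDD n v).symm⟩
    · rintro ⟨_, ⟨v, rfl⟩⟩
      exact ⟨⟨_, ⟨v, rfl⟩⟩, Subtype.ext (hDD n v)⟩
    · rintro ⟨x, ⟨v, rfl⟩⟩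
      constructor
      · intro h
        have h' : D ((D ^ n) v) = 0 := congrArg Subtype.val h
        obtain ⟨m, rfl⟩ : ∃ m, n = m + 1 := ⟨n - 1, by omega⟩
        rw [← hDD] at h'
        obtain ⟨u, hu⟩ := hK _ h'
        exact ⟨⟨_, ⟨u, rfl⟩⟩, Subtype.ext (hu.symm.trans (hDD m v))⟩
      · rintro ⟨⟨_, ⟨u, rfl⟩⟩, hu⟩
        have hu' : (D ^ (ℓ - 1)) u = (D ^ n) v := congrArg Subtype.val hu
        apply Subtype.ext
        change D ((D ^ n) v) = 0
        rw [← hu', hlast]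
    · intro u; rfl
    · intro v; exact Subtype.ext (hDT _)
  have h0 : LinearMap.trace (ZMod ℓ) V T
      = LinearMap.trace (ZMod ℓ) _ (T.restrict hKm) + t 1 := by
    refine tr_exact (LinearMap.ker D).subtype
      (D.codRestrict (LinearMap.range (D ^ 1)) ?_) Subtype.val_injective ?_ ?_ _ _ _ ?_ ?_
    · intro v; exact ⟨v, by rw [pow_one]⟩
    · rintro ⟨_, ⟨v, rfl⟩⟩
      exact ⟨v, Subtype.ext (LinearMap.congr_fun (pow_one D) v).symm⟩
    · intro v
      constructor
      · intro h
        exact ⟨⟨v, congrArg Subtype.val h⟩, rfl⟩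
      · rintro ⟨u, rfl⟩
        exact Subtype.ext u.2
    · intro u; rfl
    · intro v; exact Subtype.ext (hDT _)
  have hW : LinearMap.trace (ZMod ℓ) _ (T.restrict hKm) = t (ℓ - 1) + LinearMap.trace (ZMod ℓ) W c := by
    have hle : LinearMap.range (D ^ (ℓ - 1)) ≤ LinearMap.ker D := by
      rintro _ ⟨v, rfl⟩
      exact hlast v
    refine tr_exact (Submodule.inclusion hle) f (Submodule.inclusion_injective hle) hf ?_ _ _ _ ?_ ?_
    · intro v
      rw [hker]
      constructor
      · rintro ⟨u, hu⟩
        exact ⟨⟨_, ⟨u, rfl⟩⟩, Subtype.ext hu⟩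
      · rintro ⟨⟨_, ⟨u, rfl⟩⟩, hu⟩
        exact ⟨u, congrArg Subtype.val hu⟩
    · intro u; rfl
    · intro v; exact hc _ _ rfl
  have hend : t ℓ = 0 := by
    have : T.restrict (hR ℓ) = 0 := by
      ext ⟨_, ⟨v, rfl⟩⟩
      simp [hD]
    simp only [ht, this, map_zero]
  have hsum : ∀ n, n ≤ ℓ - 1 → t 1 = n * t (ℓ - 1) + t (n + 1) := by
    intro n
    induction n with
    | zero => intro _; simp
    | succ k ih =>
      intro hk
      rw [ih (by omega), hstep (k+1) (by omega) hk]
      push_cast; ring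
  have h1 := hsum (ℓ - 1) le_rfl
  rw [Nat.sub_add_cancel hℓ, hend, Nat.cast_sub hℓ, ZMod.natCast_self] at h1
  rw [h0, hW, h1]
  push_cast
  ring

theorem exists_red (ℓ : ℕ) [Fact ℓ.Prime]
    (M : Type*) [AddCommGroup M] [Module ℤ_[ℓ] M]
    [Module.Free ℤ_[ℓ] M] [Module.Finite ℤ_[ℓ] M] :
    ∃ (n : ℕ) (π : M →+ (Fin n → ZMod ℓ))
      (red : Module.End ℤ_[ℓ] M →+* Module.End (ZMod ℓ) (Fin n → ZMod ℓ)),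
      Function.Surjective π ∧ (∀ m, π m = 0 → ∃ w, m = (ℓ : ℤ_[ℓ]) • w) ∧
      (∀ m, π ((ℓ : ℤ_[ℓ]) • m) = 0) ∧
      (∀ f m, π (f m) = red f (π m)) ∧
      (∀ f, LinearMap.trace (ZMod ℓ) _ (red f) = PadicInt.toZMod (LinearMap.trace ℤ_[ℓ] M f)) := by
  let b := Module.finBasis ℤ_[ℓ] M
  set n := Module.finrank ℤ_[ℓ] M
  let π : M →+ (Fin n → ZMod ℓ) :=
    { toFun := fun m i => PadicInt.toZMod (b.repr m i)
      map_zero' := by ext; simp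
      map_add' := by intros; ext; simp }
  let red : Module.End ℤ_[ℓ] M →+* Module.End (ZMod ℓ) (Fin n → ZMod ℓ) :=
    ((Matrix.toLinAlgEquiv' (R := ZMod ℓ) (n := Fin n)).toRingEquiv.toRingHom.comp
      (RingHom.mapMatrix (PadicInt.toZMod))).comp (LinearMap.toMatrixAlgEquiv b).toRingEquiv.toRingHom
  have hred : ∀ f, red f = Matrix.toLin' ((LinearMap.toMatrix b b f).map PadicInt.toZMod) :=
    fun f => rfl
  have hπ : ∀ m i, π m i = PadicInt.toZMod (b.repr m i) := fun _ _ => rfl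
  refine ⟨n, π, red, ?_, ?_, ?_, ?_, ?_⟩
  · intro v
    choose x hx using fun i => ZMod.ringHom_surjective (PadicInt.toZMod (p := ℓ)) (v i)
    refine ⟨b.equivFun.symm x, ?_⟩
    ext i
    rw [hπ, ← Module.Basis.equivFun_apply, LinearEquiv.apply_symm_apply, hx]
  · intro m hm
    have : ∀ i, ∃ c, b.repr m i = ℓ * c := by
      intro i
      have h : b.repr m i ∈ RingHom.ker (PadicInt.toZMod (p := ℓ)) := by
        rw [RingHom.mem_ker, ← hπ, hm]; rfl
      rw [PadicInt.ker_toZMod, PadicInt.maximalIdeal_eq_span_p, Ideal.mem_span_singleton] at h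
      exact h
    choose c hc using this
    refine ⟨b.equivFun.symm c, ?_⟩
    apply b.equivFun.injective
    ext i
    rw [map_smul, LinearEquiv.apply_symm_apply, Module.Basis.equivFun_apply, hc]; rfl
  · intro m
    ext i
    simp [hπ]
  · intro f m
    ext i
    rw [hred, hπ, ← LinearMap.toMatrix_mulVec_repr b b f m, Matrix.toLin'_apply]
    simp [Matrix.mulVec, dotProduct, hπ]
  · intro f
    rw [hred, Matrix.trace_toLin'_eq, LinearMap.trace_eq_matrix_trace ℤ_[ℓ] b f]
    simp [Matrix.trace]


/-- Ronchetti's trace lemma: `G` a finite group with automorphism `σG` of prime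
order `ℓ`, `M` a `ℤ_ℓ[G ⋊ Γ]`-module which is finite free over `ℤ_ℓ`.  If
`Ĥ¹(Γ, M) = 0`, then for every `g ∈ G^σ` the trace of `g` on the
`𝔽_ℓ`-vector space `Ĥ⁰(Γ, M) = ker(1-σ)/im(Nr)` (presented by any
`ZMod ℓ`-linear model `(W, gW)` of it) equals the mod-`ℓ` reduction of the
trace of `g` on `M`. -/
theorem stmt_12 (ℓ : ℕ) [Fact ℓ.Prime]
    {G : Type*} [Group G] [Finite G] (σG : MulAut G) (hσG : σG ^ ℓ = 1)
    {M : Type*} [AddCommGroup M] [Module ℤ_[ℓ] M]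
    [Module.Free ℤ_[ℓ] M] [Module.Finite ℤ_[ℓ] M]
    (ρ : Representation ℤ_[ℓ] G M)
    (σM : Module.End ℤ_[ℓ] M) (hσM : σM ^ ℓ = 1)
    (hcompat : ∀ (g : G) (v : M), σM (ρ g v) = ρ (σG g) (σM v))
    (hH1 : ∀ x : M, (∑ i ∈ Finset.range ℓ, σM ^ i) x = 0 → ∃ y : M, x = y - σM y)
    (g : G) (hg : σG g = g)
    (W : Type*) [AddCommGroup W] [Module (ZMod ℓ) W]
    (gW : W →ₗ[ZMod ℓ] W)
    (e : (LinearMap.ker (1 - σM) ⧸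
        (Submodule.comap (LinearMap.ker (1 - σM)).subtype
          (LinearMap.range (∑ i ∈ Finset.range ℓ, σM ^ i)))) ≃+ W)
    (hcomm : ∀ (x y : LinearMap.ker (1 - σM)), (y : M) = ρ g (x : M) →
      gW (e (Submodule.Quotient.mk x)) = e (Submodule.Quotient.mk y)) :
    LinearMap.trace (ZMod ℓ) W gW =
      PadicInt.toZMod (LinearMap.trace ℤ_[ℓ] M (ρ g)) := by
  obtain ⟨n, π, red, hπ, hπk, hπl, hπf, htr⟩ := exists_red ℓ M
  rw [← htr]
  revert e hcomm
  generalize hN' : (∑ i ∈ Finset.range ℓ, σM ^ i) = N at hH1 ⊢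
  intro e hcomm
  have hN := hN'.symm
  have hprime : ℓ.Prime := Fact.out
  have hℓ0 : (ℓ : ℤ_[ℓ]) ≠ 0 := Nat.cast_ne_zero.2 hprime.ne_zero
  have : IsDomain ℤ_[ℓ] := inferInstance
  have hcancel : ∀ x y : M, (ℓ : ℤ_[ℓ]) • x = (ℓ : ℤ_[ℓ]) • y → x = y :=
    fun x y h => smul_right_injective M hℓ0 h
  have hND : ∀ y, N ((1 - σM) y) = 0 := by
    intro y
    have : N * (1 - σM) = 0 := by rw [hN, geom_sum_mul_neg, hσM, sub_self]
    exact LinearMap.congr_fun this y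
  have hDN : ∀ y, (1 - σM) (N y) = 0 := by
    intro y
    have : (1 - σM) * N = 0 := by rw [hN, mul_neg_geom_sum, hσM, sub_self]
    exact LinearMap.congr_fun this y
  have hNk : ∀ k, (1 - σM) k = 0 → N k = (ℓ : ℤ_[ℓ]) • k := by
    intro k hk
    have hs : σM k = k := by
      have : k - σM k = 0 := hk
      exact (sub_eq_zero.1 this).symm
    have hp : ∀ i : ℕ, (σM ^ i) k = k := by
      intro i
      induction i with
      | zero => rfl
      | succ i ih => rw [pow_succ, Module.End.mul_apply, hs, ih]
    rw [hN, LinearMap.sum_apply, Finset.sum_congr rfl (fun i _ => hp i)]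
    simp [Nat.cast_smul_eq_nsmul]
  have hH1' : ∀ x, N x = 0 → ∃ y, x = (1 - σM) y := hH1
  -- key: lifting
  have hlift : ∀ x w, (1 - σM) x = (ℓ : ℤ_[ℓ]) • w → ∃ u, (1 - σM) (x - (ℓ : ℤ_[ℓ]) • u) = 0 := by
    intro x w h
    have h1 : N w = 0 := by
      apply hcancel
      rw [← map_smul, ← h, hND, smul_zero]
    obtain ⟨u, rfl⟩ := hH1' w h1
    exact ⟨u, by rw [map_sub, h, map_smul, sub_self]⟩
  have hcommM : ∀ v, (1 - σM) (ρ g v) = ρ g ((1 - σM) v) := by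
    intro v
    change ρ g v - σM (ρ g v) = ρ g (v - σM v)
    rw [hcompat, hg, map_sub]
  have hDpow : red N = (red (1 - σM)) ^ (ℓ - 1) := by
    rw [hN, map_sum, map_sub, map_one, ← norm_eq_pow]
    simp only [map_pow]
  -- the map α : ker D → ker D̄
  let α : LinearMap.ker (1 - σM) →+ LinearMap.ker (red (1 - σM)) :=
    { toFun := fun x => ⟨π x, by rw [LinearMap.mem_ker, ← hπf, LinearMap.mem_ker.1 x.2, map_zero]⟩
      map_zero' := Subtype.ext (by simp)
      map_add' := fun x y => Subtype.ext (by simp) }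
  have hαv : ∀ x, (α x : Fin n → ZMod ℓ) = π x := fun _ => rfl
  have hα : Function.Surjective α := by
    rintro ⟨v, hv⟩
    obtain ⟨x, rfl⟩ := hπ v
    rw [LinearMap.mem_ker, ← hπf] at hv
    obtain ⟨w, hw⟩ := hπk _ hv
    obtain ⟨u, hu⟩ := hlift x w hw
    exact ⟨⟨_, hu⟩, Subtype.ext (by rw [hαv]; simp [hπl])⟩
  let γ : LinearMap.ker (1 - σM) →+ W :=
    (e : _ →+ W).comp (Submodule.mkQ (Submodule.comap (LinearMap.ker (1 - σM)).subtype
          (LinearMap.range N))).toAddMonoidHom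
  have hγv : ∀ x, γ x = e (Submodule.Quotient.mk x) := fun _ => rfl
  have hγ0 : ∀ x, γ x = 0 ↔ ∃ u, N u = x := by
    intro x
    rw [hγv, EmbeddingLike.map_eq_zero_iff, Submodule.Quotient.mk_eq_zero]
    rfl
  have hαγ : ∀ x, α x = 0 → γ x = 0 := by
    intro x hx
    obtain ⟨w, hw⟩ := hπk _ (congrArg Subtype.val hx)
    rw [hγ0]
    refine ⟨w, ?_⟩
    rw [hw, hNk]
    apply hcancel
    rw [← map_smul, ← hw, smul_zero]
    exact x.2
  let f₀ : LinearMap.ker (red (1 - σM)) →+ W := α.liftOfSurjective hα ⟨γ, hαγ⟩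
  have hf₀ : ∀ x, f₀ (α x) = γ x := fun x => α.liftOfRightInverse_comp_apply _ _ ⟨γ, hαγ⟩ x
  let f := f₀.toZModLinearMap ℓ
  have hf : ∀ x, f (α x) = γ x := hf₀
  refine tr_main ℓ (red (1 - σM)) (red (ρ g)) ?_ ?_ ?_ f ?_ ?_ gW ?_
  · intro v
    obtain ⟨x, rfl⟩ := hπ v
    simp only [← hπf, hcommM]
  · have : (1 - σM) * N = 0 := LinearMap.ext hDN
    rw [← mul_pow_sub_one hprime.ne_zero, ← hDpow, ← map_mul, this, map_zero]
  · intro v hv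
    obtain ⟨y, rfl⟩ := hπ v
    rw [← hπf, ← hπf] at hv
    obtain ⟨w, hw⟩ := hπk _ hv
    obtain ⟨u, hu⟩ := hlift _ w hw
    refine ⟨π (-u), ?_⟩
    rw [← hDpow, ← hπf, ← hπf]
    have h2 := hNk _ hu
    rw [map_sub, hND, map_smul, zero_sub, ← smul_neg] at h2
    have h3 := hcancel _ _ h2
    rw [map_neg, h3, map_sub, hπl, sub_zero]
  · intro w
    obtain ⟨q, rfl⟩ := e.surjective w
    obtain ⟨x, rfl⟩ := Submodule.Quotient.mk_surjective _ q
    exact ⟨α x, hf x⟩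
  · intro v
    obtain ⟨x, rfl⟩ := hα v
    rw [hf, hγ0, ← hDpow]
    constructor
    · rintro ⟨u, hu⟩
      exact ⟨π u, by rw [← hπf, hu]; rfl⟩
    · rintro ⟨u, hu⟩
      obtain ⟨m, rfl⟩ := hπ u
      rw [← hπf] at hu
      obtain ⟨z, hz⟩ : ∃ z : LinearMap.ker (1 - σM), (z : M) = N m :=
        ⟨⟨N m, LinearMap.mem_ker.2 (hDN m)⟩, rfl⟩
      have hzx : α z = α x := Subtype.ext (by rw [hαv, hz, hu])
      have hx : α (z - x) = 0 := (map_sub α z x).trans (sub_eq_zero.2 hzx)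
      have h4 := hαγ _ hx
      rw [map_sub γ z x, (hγ0 z).2 ⟨m, hz.symm⟩, zero_sub, neg_eq_zero] at h4
      exact (hγ0 x).1 h4
  · intro v w hw
    obtain ⟨x, rfl⟩ := hα v
    have hy : ρ g (x : M) ∈ LinearMap.ker (1 - σM) := by
      rw [LinearMap.mem_ker, hcommM, LinearMap.mem_ker.1 x.2, map_zero]
    have : w = α ⟨_, hy⟩ := Subtype.ext (by rw [hw, hαv, hαv, hπf])
    rw [this, hf, hf, hγv, hγv]
    exact (hcomm x ⟨_, hy⟩ rfl).symm
end

section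
/- Let Γ = ⟨σ⟩ be cyclic of prime order ℓ and let M be a ℤ_ℓ[Γ]-module that is finitely generated and free as a ℤ_ℓ-module. If Ĥ¹(Γ, M) = 0, then M is isomorphic as a ℤ_ℓ[Γ]-module to a direct sum of copies of modules each of which is isomorphic to either ℤ_ℓ with trivial Γ-action or the regular module ℤ_ℓ[Γ]. -/
lemma aux_nakayama (ℓ : ℕ) [Fact ℓ.Prime] {L : Type*} [AddCommGroup L] [Module ℤ_[ℓ] L]
    [Module.Finite ℤ_[ℓ] L] (T : Module.End ℤ_[ℓ] L) (hT : T ^ ℓ = 1)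
    (hs : ∀ x : L, ∃ y : L, x = y - T y) (x : L) : x = 0 := by
  have hp : ℓ.Prime := Fact.out
  have hD : Function.Surjective (1 - T : Module.End ℤ_[ℓ] L) := by
    intro x
    obtain ⟨y, hy⟩ := hs x
    exact ⟨y, by simp [hy]⟩
  have hDl : ∀ k : ℕ, Function.Surjective ((1 - T : Module.End ℤ_[ℓ] L) ^ k) := by
    intro k
    rw [Module.End.coe_pow]
    exact hD.iterate k
  have hu : ∃ u : Module.End ℤ_[ℓ] L, (1 - T) ^ ℓ = (ℓ : Module.End ℤ_[ℓ] L) * u := by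
    obtain ⟨r, hr⟩ := (Commute.one_left (-T)).exists_add_pow_prime_eq hp
    rw [← sub_eq_add_neg] at hr
    rcases hp.eq_two_or_odd' with h2 | hodd
    · subst h2
      refine ⟨1 + 1 * (-T) * r, ?_⟩
      rw [hr, neg_sq, hT, mul_add]
      norm_num [mul_assoc]
    · refine ⟨1 * (-T) * r, ?_⟩
      rw [hr, hodd.neg_pow, hT]
      simp [mul_assoc]
  obtain ⟨u, hu⟩ := hu
  have htop : (⊤ : Submodule ℤ_[ℓ] L) = ⊥ := by
    apply Submodule.eq_bot_of_le_smul_of_le_jacobson_bot (Ideal.span {(ℓ : ℤ_[ℓ])}) _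
      Module.Finite.fg_top
    · intro x _
      obtain ⟨y, hy⟩ := hDl ℓ x
      rw [hu] at hy
      have : x = (ℓ : ℤ_[ℓ]) • u y := by
        rw [← hy, Nat.cast_smul_eq_nsmul]
        simp
      rw [this]
      exact Submodule.smul_mem_smul (Ideal.mem_span_singleton_self _) trivial
    · rw [IsLocalRing.jacobson_eq_maximalIdeal ⊥ bot_ne_top, PadicInt.maximalIdeal_eq_span_p]
  have : x ∈ (⊤ : Submodule ℤ_[ℓ] L) := trivial
  rw [htop] at this
  simpa using this

lemma aux_basis (ℓ : ℕ) [Fact ℓ.Prime] {P : Type*} [AddCommGroup P] [Module ℤ_[ℓ] P]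
    [Module.Free ℤ_[ℓ] P] [Module.Finite ℤ_[ℓ] P] (Q : Submodule ℤ_[ℓ] P) :
    ∃ (n m : ℕ) (b : Module.Basis (Fin n ⊕ Fin m) ℤ_[ℓ] P),
      (∀ i, b (Sum.inr i) ∈ Q) ∧ ∀ y ∈ Q, ∀ j, (ℓ : ℤ_[ℓ]) ∣ b.repr y (Sum.inl j) := by
  classical
  obtain ⟨r, s⟩ := Submodule.smithNormalForm (Module.finBasis ℤ_[ℓ] P) Q
  let p : Fin (Module.finrank ℤ_[ℓ] P) → Prop := fun k => s.bM k ∈ Q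
  let eq1 : {k // ¬ p k} ⊕ {k // p k} ≃ Fin (Module.finrank ℤ_[ℓ] P) :=
    (Equiv.sumComm _ _).trans (Equiv.sumCompl p)
  let eq2 := (Equiv.sumCongr (Fintype.equivFin {k // ¬ p k}) (Fintype.equivFin {k // p k}))
  let E := eq1.symm.trans eq2
  refine ⟨_, _, s.bM.reindex E, ?_, ?_⟩
  · intro i
    have : (s.bM.reindex E) (Sum.inr i) = s.bM ((Fintype.equivFin {k // p k}).symm i) := by
      simp [E, eq1, eq2]
    rw [this]
    exact ((Fintype.equivFin {k // p k}).symm i).2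
  · intro y hy j
    set k := (Fintype.equivFin {k // ¬ p k}).symm j with hk
    have h1 : (s.bM.reindex E).repr y (Sum.inl j) = s.bM.repr y k := by
      rw [Module.Basis.repr_reindex_apply]
      simp [E, eq1, eq2, hk]
    rw [h1]
    have hkp : ¬ p k := k.2
    by_cases hr : (k : Fin _) ∈ Set.range s.f
    · obtain ⟨i, hi⟩ := hr
      have h2 := s.repr_apply_embedding_eq_repr_smul (m := ⟨y, hy⟩) (i := i)
      rw [hi] at h2
      simp only at h2
      rw [h2]
      have ha : (ℓ : ℤ_[ℓ]) ∣ s.a i := by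
        by_contra hnd
        have hunit : IsUnit (s.a i) := by
          by_contra hnu
          have : s.a i ∈ IsLocalRing.maximalIdeal ℤ_[ℓ] := hnu
          rw [PadicInt.maximalIdeal_eq_span_p, Ideal.mem_span_singleton] at this
          exact hnd this
        apply hkp
        have h3 := s.snf i
        rw [hi] at h3
        have h4 : s.a i • s.bM k ∈ Q := h3 ▸ (s.bN i).2
        exact (Submodule.smul_mem_iff_of_isUnit Q hunit).1 h4
      simp only [map_smul, Finsupp.smul_apply, smul_eq_mul]
      exact Dvd.dvd.mul_right ha _
    · have h2 := s.repr_eq_zero_of_notMem_range ⟨y, hy⟩ hr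
      simp only at h2
      rw [h2]
      exact dvd_zero _

lemma aux_sum_range (ℓ : ℕ) [Fact ℓ.Prime] {A : Type*} [AddCommMonoid A] (F : ℕ → A) :
    ∑ k : ZMod ℓ, F k.val = ∑ i ∈ Finset.range ℓ, F i := by
  have hp : ℓ.Prime := Fact.out
  refine Finset.sum_bij' (fun k _ => k.val) (fun i _ => (i : ZMod ℓ)) ?_ ?_ ?_ ?_ ?_
  · intro k _
    simpa using ZMod.val_lt k
  · simp
  · simp
  · intro i hi
    exact ZMod.val_cast_of_lt (by simpa using hi)
  · simp

lemma aux_regular (ℓ : ℕ) [Fact ℓ.Prime] (g : ZMod ℓ → ℤ_[ℓ]) (hg : ∑ k, g k = 0) :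
    ∃ h : ZMod ℓ → ℤ_[ℓ], ∀ k, g k = h k - h (k - 1) := by
  have hp : ℓ.Prime := Fact.out
  have hH : ∀ k : ZMod ℓ, ∑ i ∈ Finset.range ((k - 1).val + 1), g i
      = ∑ i ∈ Finset.range k.val, g i := by
    intro k
    have hg' : ∑ i ∈ Finset.range ℓ, g i = 0 := by
      rw [← aux_sum_range ℓ (fun i => g i), ← hg]
      simp
    have hlt := ZMod.val_lt (k - 1)
    have hk : k = (((k - 1).val + 1 : ℕ) : ZMod ℓ) := by simp
    rcases Nat.lt_or_ge ((k - 1).val + 1) ℓ with h | h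
    · have : k.val = (k - 1).val + 1 := by
        conv_lhs => rw [hk]
        exact ZMod.val_cast_of_lt h
      rw [this]
    · have h' : (k - 1).val + 1 = ℓ := by omega
      have : k = 0 := by rw [hk, h']; simp
      rw [h', hg', this]
      simp
  refine ⟨fun k => ∑ i ∈ Finset.range (k.val + 1), g i, fun k => ?_⟩
  simp only
  rw [hH, Finset.sum_range_succ]
  simp

/-- Let `Γ = ⟨σ⟩` be cyclic of prime order `ℓ` and `M` a `ℤ_ℓ[Γ]`-module which
is finite free over `ℤ_ℓ`.  If `Ĥ¹(Γ, M) = 0`, then `M` is isomorphic as a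
`ℤ_ℓ[Γ]`-module to a direct sum of `n` copies of the trivial module `ℤ_ℓ` and
`m` copies of the regular module `ℤ_ℓ[Γ]` (functions `ℤ/ℓ → ℤ_ℓ` with `σ`
acting by the index shift). -/
theorem stmt_13 (ℓ : ℕ) [Fact ℓ.Prime]
    {M : Type*} [AddCommGroup M] [Module ℤ_[ℓ] M]
    [Module.Free ℤ_[ℓ] M] [Module.Finite ℤ_[ℓ] M]
    (σM : Module.End ℤ_[ℓ] M) (hσM : σM ^ ℓ = 1)
    (hH1 : ∀ x : M, (∑ i ∈ Finset.range ℓ, σM ^ i) x = 0 →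
      ∃ y : M, x = y - σM y) :
    ∃ (n m : ℕ)
      (e : M ≃ₗ[ℤ_[ℓ]] (Fin n → ℤ_[ℓ]) × (Fin m → ZMod ℓ → ℤ_[ℓ])),
      ∀ x : M, e (σM x) = ((e x).1, fun j i => (e x).2 j (i - 1)) := by
  classical
  have hp : ℓ.Prime := Fact.out
  have hl0 : (ℓ : ℤ_[ℓ]) ≠ 0 := by exact_mod_cast hp.ne_zero
  set N : Module.End ℤ_[ℓ] M := ∑ i ∈ Finset.range ℓ, σM ^ i with hN
  let P : Submodule ℤ_[ℓ] M := LinearMap.ker (1 - σM : Module.End ℤ_[ℓ] M)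
  have hP : ∀ x, x ∈ P ↔ σM x = x := by
    intro x
    rw [LinearMap.mem_ker, LinearMap.sub_apply, Module.End.one_apply, sub_eq_zero, eq_comm]
  have hσN : σM * N = N := by
    have h := mul_geom_sum σM ℓ
    rw [hσM, sub_self, sub_mul, one_mul, sub_eq_zero] at h
    exact h
  have hNσ : N * σM = N := by
    have h := geom_sum_mul σM ℓ
    rw [hσM, sub_self, mul_sub, mul_one, sub_eq_zero] at h
    exact h
  have hNP : ∀ x, N x ∈ P := by
    intro x
    rw [hP, ← Module.End.mul_apply, hσN]
  have hNσk : ∀ (k : ℕ) x, N ((σM ^ k) x) = N x := by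
    intro k x
    induction k with
    | zero => simp
    | succ k ih => rw [pow_succ', Module.End.mul_apply, ← Module.End.mul_apply, hNσ, ih]
  have hNfix : ∀ x ∈ P, N x = (ℓ : ℤ_[ℓ]) • x := by
    intro x hx
    rw [hP] at hx
    have : ∀ k : ℕ, (σM ^ k) x = x := by
      intro k
      induction k with
      | zero => simp
      | succ k ih => rw [pow_succ', Module.End.mul_apply, ih, hx]
    rw [hN, LinearMap.sum_apply, Finset.sum_congr rfl (fun k _ => this k)]
    simp [Nat.cast_smul_eq_nsmul]
  let Q : Submodule ℤ_[ℓ] P := (LinearMap.range N).comap P.subtype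
  obtain ⟨n, m, b, hbQ, hbd⟩ := aux_basis ℓ Q
  have hx : ∀ i, ∃ x : M, N x = b (Sum.inr i) := fun i => by
    obtain ⟨x, hx⟩ := hbQ i
    exact ⟨x, hx⟩
  choose x hx using hx
  have hexp : ∀ y (hy : y ∈ P), y = ∑ j, b.repr ⟨y, hy⟩ (Sum.inl j) • (b (Sum.inl j) : M)
      + ∑ i, b.repr ⟨y, hy⟩ (Sum.inr i) • (b (Sum.inr i) : M) := by
    intro y hy
    have h := congrArg (P.subtype) (b.sum_repr ⟨y, hy⟩)
    rw [map_sum, Fintype.sum_sum_type] at h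
    exact h.symm
  have hind : ∀ (c : Fin n → ℤ_[ℓ]) (d : Fin m → ℤ_[ℓ]),
      ∑ j, c j • (b (Sum.inl j) : M) + ∑ i, d i • (b (Sum.inr i) : M) = 0 →
      (∀ j, c j = 0) ∧ ∀ i, d i = 0 := by
    intro c d h
    have h2 : ∑ t, (Sum.elim c d t) • b t = 0 := by
      apply Subtype.ext
      rw [Fintype.sum_sum_type]
      simpa using h
    have h3 := Fintype.linearIndependent_iff.1 b.linearIndependent _ h2
    exact ⟨fun j => h3 (Sum.inl j), fun i => h3 (Sum.inr i)⟩
  -- the model module, its endomorphism and the comparison map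
  let S : Module.End ℤ_[ℓ] ((Fin n → ℤ_[ℓ]) × (Fin m → ZMod ℓ → ℤ_[ℓ])) :=
    { toFun := fun v => (v.1, fun j i => v.2 j (i - 1))
      map_add' := fun _ _ => rfl
      map_smul' := fun _ _ => rfl }
  have hS : ∀ v, S v = (v.1, fun j i => v.2 j (i - 1)) := fun _ => rfl
  have hSk : ∀ (k : ℕ) v, (S ^ k) v = (v.1, fun j i => v.2 j (i - k)) := by
    intro k v
    induction k with
    | zero => simp
    | succ k ih =>
      rw [pow_succ', Module.End.mul_apply, ih, hS]
      simp [sub_sub, add_comm]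
  have hSl : S ^ ℓ = 1 := by
    apply LinearMap.ext
    intro v
    rw [hSk]
    simp
  let φ : ((Fin n → ℤ_[ℓ]) × (Fin m → ZMod ℓ → ℤ_[ℓ])) →ₗ[ℤ_[ℓ]] M :=
    { toFun := fun v => ∑ j, v.1 j • (b (Sum.inl j) : M)
        + ∑ i, ∑ k : ZMod ℓ, v.2 i k • (σM ^ k.val) (x i)
      map_add' := fun v w => by
        simp only [Prod.fst_add, Prod.snd_add, Pi.add_apply, add_smul, Finset.sum_add_distrib]
        abel
      map_smul' := fun r v => by
        simp only [Prod.smul_fst, Prod.smul_snd, Pi.smul_apply, smul_eq_mul, mul_smul,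
          Finset.smul_sum, smul_add, RingHom.id_apply] }
  have hφ : ∀ v, φ v = ∑ j, v.1 j • (b (Sum.inl j) : M)
        + ∑ i, ∑ k : ZMod ℓ, v.2 i k • (σM ^ k.val) (x i) := fun _ => rfl
  have hshift : ∀ k : ZMod ℓ, σM ^ (k + 1).val = σM ^ (k.val + 1) := by
    intro k
    have h1 : (k + 1).val = (k.val + 1) % ℓ := by
      rw [ZMod.val_add, ZMod.val_one]
    rw [h1, ← pow_eq_pow_mod _ hσM]
  have hφS : ∀ v, φ (S v) = σM (φ v) := by
    intro v
    rw [hφ, hφ, hS]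
    simp only [map_add, map_sum, map_smul]
    congr 1
    · refine Finset.sum_congr rfl fun j _ => ?_
      rw [(hP _).1 (b (Sum.inl j)).2]
    · refine Finset.sum_congr rfl fun i _ => ?_
      rw [← Equiv.sum_comp (Equiv.addRight (1 : ZMod ℓ))]
      refine Finset.sum_congr rfl fun k _ => ?_
      simp only [Equiv.coe_addRight, add_sub_cancel_right]
      rw [hshift, pow_succ', Module.End.mul_apply]
  have hNφ : ∀ v, N (φ v) = ∑ j, ((ℓ : ℤ_[ℓ]) * v.1 j) • (b (Sum.inl j) : M)
      + ∑ i, (∑ k, v.2 i k) • (b (Sum.inr i) : M) := by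
    intro v
    rw [hφ]
    simp only [map_add, map_sum, map_smul]
    congr 1
    · refine Finset.sum_congr rfl fun j _ => ?_
      rw [hNfix _ (b (Sum.inl j)).2, smul_smul, mul_comm]
    · refine Finset.sum_congr rfl fun i _ => ?_
      rw [Finset.sum_smul]
      refine Finset.sum_congr rfl fun k _ => ?_
      rw [hNσk, hx]
  have hφconst : ∀ (c : Fin n → ℤ_[ℓ]) (d : Fin m → ℤ_[ℓ]),
      φ (c, fun i _ => d i) = ∑ j, c j • (b (Sum.inl j) : M)
        + ∑ i, d i • (b (Sum.inr i) : M) := by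
    intro c d
    rw [hφ]
    congr 1
    refine Finset.sum_congr rfl fun i _ => ?_
    rw [← Finset.smul_sum, aux_sum_range ℓ (fun k => (σM ^ k) (x i)), ← hx, hN,
      LinearMap.sum_apply]
  -- surjectivity
  have hsurj : Function.Surjective φ := by
    let R' := LinearMap.range φ
    have hR' : R' ≤ R'.comap σM := by
      rintro _ ⟨v, rfl⟩
      exact ⟨S v, hφS v⟩
    let T : Module.End ℤ_[ℓ] (M ⧸ R') := R'.mapQ R' σM hR'
    have hTm : ∀ y : M, T (R'.mkQ y) = R'.mkQ (σM y) := fun y => rfl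
    have hTk : ∀ (k : ℕ) (y : M), (T ^ k) (R'.mkQ y) = R'.mkQ ((σM ^ k) y) := by
      intro k y
      induction k with
      | zero => simp
      | succ k ih => rw [pow_succ', pow_succ', Module.End.mul_apply, ih, hTm,
          Module.End.mul_apply]
    have hTl : T ^ ℓ = 1 := by
      apply LinearMap.ext
      intro z
      obtain ⟨y, rfl⟩ := R'.mkQ_surjective z
      rw [hTk, hσM]
      rfl
    have key := aux_nakayama ℓ T hTl (by
      intro z
      obtain ⟨y, rfl⟩ := R'.mkQ_surjective z
      have hQ : (⟨N y, hNP y⟩ : P) ∈ Q := ⟨y, rfl⟩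
      choose c hc using hbd _ hQ
      let v : (Fin n → ℤ_[ℓ]) × (Fin m → ZMod ℓ → ℤ_[ℓ]) :=
        (c, fun i => Pi.single 0 (b.repr ⟨N y, hNP y⟩ (Sum.inr i)))
      have hv : N (φ v) = N y := by
        rw [hNφ, hexp (N y) (hNP y)]
        simp only [hc, v]
        congr 1
        refine Finset.sum_congr rfl fun i _ => ?_
        rw [Finset.sum_pi_single']
        simp
      obtain ⟨w, hw⟩ := hH1 (y - φ v) (by rw [map_sub, hv, sub_self])
      refine ⟨R'.mkQ w, ?_⟩
      rw [hTm, ← map_sub, ← hw, map_sub]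
      have : R'.mkQ (φ v) = 0 := by
        rw [Submodule.mkQ_apply, Submodule.Quotient.mk_eq_zero]
        exact ⟨v, rfl⟩
      rw [this, sub_zero])
    intro y
    have := key (R'.mkQ y)
    rw [Submodule.mkQ_apply, Submodule.Quotient.mk_eq_zero] at this
    exact this
  -- injectivity
  have hinj : Function.Injective φ := by
    rw [injective_iff_map_eq_zero]
    intro v hv
    let K := LinearMap.ker φ
    have hK : ∀ w ∈ K, S w ∈ K := by
      intro w hw
      rw [LinearMap.mem_ker] at hw ⊢
      rw [hφS, hw, map_zero]
    let T : Module.End ℤ_[ℓ] K := S.restrict hK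
    have hTk : ∀ (k : ℕ) (w : K), (((T ^ k) w : K) : (Fin n → ℤ_[ℓ]) × (Fin m → ZMod ℓ → ℤ_[ℓ]))
        = (S ^ k) w := by
      intro k w
      induction k with
      | zero => simp
      | succ k ih =>
        rw [pow_succ', pow_succ', Module.End.mul_apply, Module.End.mul_apply, ← ih]
        rfl
    have hTl : T ^ ℓ = 1 := by
      apply LinearMap.ext
      intro w
      apply Subtype.ext
      rw [hTk, hSl]
      rfl
    have key := aux_nakayama ℓ T hTl (by
      rintro ⟨w, hw⟩
      have hw' : φ w = 0 := hw
      have h1 := hNφ w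
      rw [hw', map_zero] at h1
      obtain ⟨h2, h3⟩ := hind _ _ h1.symm
      have h4 : ∀ j, w.1 j = 0 := fun j => (mul_eq_zero.1 (h2 j)).resolve_left hl0
      choose h hh using fun i => aux_regular ℓ (w.2 i) (h3 i)
      have h5 : φ (0, h) ∈ P := by
        rw [hP, ← hφS, ← sub_eq_zero, ← map_sub, ← neg_eq_zero, ← map_neg, ← hw']
        congr 1
        rw [hS]
        ext t
        · simp [h4]
        · simp [hh]
      let z : (Fin n → ℤ_[ℓ]) × (Fin m → ZMod ℓ → ℤ_[ℓ]) :=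
        (fun j => b.repr ⟨_, h5⟩ (Sum.inl j), fun i _ => b.repr ⟨_, h5⟩ (Sum.inr i))
      have h6 : φ z = φ (0, h) := by
        rw [hφconst]
        exact (hexp _ h5).symm
      refine ⟨⟨(0, h) - z, ?_⟩, ?_⟩
      · rw [LinearMap.mem_ker, map_sub, h6, sub_self]
      · apply Subtype.ext
        change w = ((0, h) - z) - S ((0, h) - z)
        rw [hS]
        ext t
        · simp [h4]
        · simp [hh, z])
    exact congrArg Subtype.val (key ⟨v, hv⟩)
  let e := (LinearEquiv.ofBijective φ ⟨hinj, hsurj⟩).symm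
  refine ⟨n, m, e, fun y => ?_⟩
  rw [← hS]
  apply hinj
  rw [hφS]
  have he : ∀ y, φ (e y) = y := fun y =>
    (LinearEquiv.ofBijective φ ⟨hinj, hsurj⟩).apply_symm_apply y
  rw [he, he]
end
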